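/- arXiv:2208.04801 — 3 statements merged into one kernel-verified Lean document; each statement's English description precedes it below -/
import Mathlib

section
/- The sequence h_n(1) = n^{−1}·J_n(1) converges to 9/π as n → ∞; equivalently, (1/n!)·6^{−n}·Σ_{g=0}^{n} H(n,g) ∼ (9/π)·n. -/
open Filter Finset

set_option linter.unusedSimpArgs false

open PowerSeries in
lemma hh_d2 : d⁄dX ℝ (2 : ℝ⟦X⟧) = 0 := by
  simpa using (d⁄dX ℝ).map_natCast 2

open PowerSeries in
lemma hh_d3 : d⁄dX ℝ (3 : ℝ⟦X⟧) = 0 := by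
  simpa using (d⁄dX ℝ).map_natCast 3

open PowerSeries in
lemma hh_d4 : d⁄dX ℝ (4 : ℝ⟦X⟧) = 0 := by
  simpa using (d⁄dX ℝ).map_natCast 4

open PowerSeries in
lemma hh_d6 : d⁄dX ℝ (6 : ℝ⟦X⟧) = 0 := by
  simpa using (d⁄dX ℝ).map_natCast 6

open PowerSeries in
lemma hh_d12 : d⁄dX ℝ (12 : ℝ⟦X⟧) = 0 := by
  simpa using (d⁄dX ℝ).map_natCast 12

/-- Weighted numbers of (not necessarily connected) cubic maps. -/
noncomputable def hh_c : ℕ → ℝ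
  | 0 => 1
  | n + 1 => (6 * n + 1) * (6 * n + 5) / (6 * (n + 1)) * hh_c n

lemma hh_c_pos (n : ℕ) : 0 < hh_c n := by
  induction n with
  | zero => simp [hh_c]
  | succ n ih => rw [hh_c]; positivity

noncomputable def hh_Z : PowerSeries ℝ := PowerSeries.mk hh_c

section
open PowerSeries

lemma hh_Z_ode : 6 * d⁄dX ℝ hh_Z = 36 * (X * (X * d⁄dX ℝ (d⁄dX ℝ hh_Z)))
    + 72 * (X * d⁄dX ℝ hh_Z) + 5 * hh_Z := by
  have e6 : (6 : ℝ⟦X⟧) = C 6 := (map_ofNat C 6).symm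
  have e36 : (36 : ℝ⟦X⟧) = C 36 := (map_ofNat C 36).symm
  have e72 : (72 : ℝ⟦X⟧) = C 72 := (map_ofNat C 72).symm
  have e5 : (5 : ℝ⟦X⟧) = C 5 := (map_ofNat C 5).symm
  rw [e6, e36, e72, e5]
  ext n
  have key : ∀ n : ℕ, 6 * ((n : ℝ) + 1) * hh_c (n + 1) = (6 * n + 1) * (6 * n + 5) * hh_c n := by
    intro n
    rw [hh_c]
    field_simp
  have k := key n
  rcases n with _ | _ | n
  · simp [coeff_derivative, hh_Z, coeff_C_mul] at k ⊢
    linarith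
  · simp [coeff_derivative, hh_Z, coeff_C_mul, coeff_succ_X_mul] at k ⊢
    linarith
  · simp [coeff_derivative, hh_Z, coeff_C_mul, coeff_succ_X_mul] at k ⊢
    linarith

noncomputable def hh_R : PowerSeries ℝ := 6 * X * d⁄dX ℝ hh_Z * hh_Z⁻¹

lemma hh_Z_ne : constantCoeff hh_Z ≠ 0 := by
  rw [← coeff_zero_eq_constantCoeff_apply]
  simp [hh_Z, hh_c]

lemma hh_Z_ne' : hh_Z ≠ 0 := fun h => hh_Z_ne (by rw [h]; simp)

lemma hh_RZ : hh_R * hh_Z = 6 * X * d⁄dX ℝ hh_Z := by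
  have := PowerSeries.mul_inv_cancel hh_Z hh_Z_ne
  rw [hh_R]
  linear_combination (6 * X * d⁄dX ℝ hh_Z) * this

lemma hh_riccati : hh_R = X * (6 * (X * d⁄dX ℝ hh_R) + hh_R * hh_R + 6 * hh_R + 5) := by
  have h1 := hh_RZ
  have h2 := congrArg (d⁄dX ℝ) h1
  simp only [Derivation.leibniz, smul_eq_mul, hh_d2, hh_d3, hh_d4, hh_d6, hh_d12, map_zero, derivative_X] at h2
  have h3 := hh_Z_ode
  have hz := hh_Z_ne'
  have hzz : hh_Z * hh_Z ≠ 0 := mul_ne_zero hz hz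
  apply mul_right_cancel₀ hzz
  generalize d⁄dX ℝ (d⁄dX ℝ hh_Z) = z2 at *
  generalize d⁄dX ℝ hh_Z = z1 at *
  generalize d⁄dX ℝ hh_R = r1 at *
  generalize hh_Z = z at *
  generalize hh_R = r at *
  linear_combination (z - X * (r * z + 6 * z) + 0 * X) * h1 - 6 * X^2 * z * h2 + X * z * h3

noncomputable def hh_U : PowerSeries ℝ := 2 * X - 1 + 2 * X * hh_R

lemma hh_U_eq : hh_U * hh_U + 12 * (X * X * d⁄dX ℝ hh_U) - 4 * (X * hh_U) = 1 := by
  have h := hh_riccati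
  have h2 : d⁄dX ℝ hh_U = 2 + 2 * hh_R + 2 * X * d⁄dX ℝ hh_R := by
    simp only [hh_U, map_sub, map_add, Derivation.leibniz, smul_eq_mul, hh_d2, hh_d3, hh_d4, hh_d6, hh_d12, map_zero, derivative_X,
      Derivation.map_one_eq_zero]
    ring
  rw [h2, hh_U]
  linear_combination (-4) * X * h

noncomputable def hh_B : PowerSeries ℝ := 3 * X * d⁄dX ℝ hh_U - hh_U

lemma hh_B_eq : d⁄dX ℝ hh_U = 4 * (X * hh_B) + 28 * (X * (X * d⁄dX ℝ hh_B))
    + 12 * (X * (X * (X * d⁄dX ℝ (d⁄dX ℝ hh_B)))) + 2 * (hh_B * hh_B) := by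
  have h := hh_U_eq
  have h1 := congrArg (d⁄dX ℝ) h
  simp only [map_sub, map_add, Derivation.leibniz, smul_eq_mul, hh_d2, hh_d3, hh_d4, hh_d6, hh_d12, map_zero, derivative_X,
      Derivation.map_one_eq_zero] at h1
  have h2 := congrArg (d⁄dX ℝ) h1
  simp only [map_sub, map_add, Derivation.leibniz, smul_eq_mul, hh_d2, hh_d3, hh_d4, hh_d6, hh_d12, map_zero, derivative_X,
      Derivation.map_one_eq_zero] at h2
  simp only [hh_B, map_sub, map_add, Derivation.leibniz, smul_eq_mul, hh_d2, hh_d3, hh_d4, hh_d6, hh_d12, map_zero, derivative_X,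
      Derivation.map_one_eq_zero]
  generalize d⁄dX ℝ (d⁄dX ℝ (d⁄dX ℝ hh_U)) = u3 at *
  generalize d⁄dX ℝ (d⁄dX ℝ hh_U) = u2 at *
  generalize d⁄dX ℝ hh_U = u1 at *
  generalize hh_U = u at *
  have two_ne : (2 : ℝ⟦X⟧) ≠ 0 := by
    intro h0
    have := congrArg constantCoeff h0
    rw [map_ofNat, map_zero] at this
    norm_num at this
  apply mul_left_cancel₀ two_ne
  linear_combination (-6*X^2) * h2 - (2*X - u) * h1 - 2 * u1 * h

end

section
open PowerSeries

noncomputable def hh_rho (n : ℕ) : ℝ := coeff n hh_R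
noncomputable def hh_b (n : ℕ) : ℝ := coeff n hh_B / 2

lemma hh_rho_zero : hh_rho 0 = 0 := by
  rw [hh_rho, hh_riccati]; simp

lemma hh_rho_succ (n : ℕ) : hh_rho (n + 1) = 6 * (n + 1) * hh_rho n
    + ∑ p ∈ antidiagonal n, hh_rho p.1 * hh_rho p.2 + if n = 0 then 5 else 0 := by
  have e6 : (6 : ℝ⟦X⟧) = C 6 := (map_ofNat C 6).symm
  have e5 : (5 : ℝ⟦X⟧) = C 5 := (map_ofNat C 5).symm
  have h := congrArg (coeff (n + 1)) hh_riccati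
  rw [coeff_succ_X_mul, e6, e5] at h
  simp only [map_add, coeff_C_mul, coeff_mul _ hh_R hh_R, coeff_C] at h
  simp only [hh_rho]
  rw [h]
  rcases n with _ | n
  · simp
    ring
  · simp [coeff_derivative, coeff_succ_X_mul]
    ring

lemma hh_rho_nonneg (n : ℕ) : 0 ≤ hh_rho n := by
  induction n using Nat.strong_induction_on with
  | _ n ih =>
    rcases n with _ | n
    · rw [hh_rho_zero]
    · rw [hh_rho_succ]
      have h1 := ih n (by omega)
      have h2 : 0 ≤ ∑ p ∈ antidiagonal n, hh_rho p.1 * hh_rho p.2 := by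
        apply Finset.sum_nonneg
        intro p hp
        rw [HasAntidiagonal.mem_antidiagonal] at hp
        exact mul_nonneg (ih _ (by omega)) (ih _ (by omega))
      have h3 : (0 : ℝ) ≤ if n = 0 then 5 else 0 := by split_ifs <;> norm_num
      have h4 : 0 ≤ 6 * ((n : ℝ) + 1) * hh_rho n := by positivity
      linarith

lemma hh_conv (n : ℕ) : ∑ p ∈ antidiagonal n, hh_rho p.1 * hh_c p.2 = 6 * n * hh_c n := by
  have e6 : (6 : ℝ⟦X⟧) = C 6 := (map_ofNat C 6).symm
  have h := congrArg (coeff n) hh_RZ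
  rw [coeff_mul, e6, mul_assoc, coeff_C_mul] at h
  have h2 : ∑ p ∈ antidiagonal n, hh_rho p.1 * hh_c p.2 =
    ∑ p ∈ antidiagonal n, (coeff p.1) hh_R * (coeff p.2) hh_Z := by simp [hh_rho, hh_Z]
  rw [h2, h]
  rcases n with _ | n
  · simp
  · simp [coeff_succ_X_mul, coeff_derivative, hh_Z]
    ring

lemma hh_coeff_B (n : ℕ) : coeff n hh_B = (3 * n - 1) * coeff n hh_U := by
  have e3 : (3 : ℝ⟦X⟧) = C 3 := (map_ofNat C 3).symm
  rw [hh_B, e3, mul_assoc, map_sub, coeff_C_mul]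
  rcases n with _ | n
  · simp
  · simp [coeff_succ_X_mul, coeff_derivative]
    ring

lemma hh_U_zero : coeff 0 hh_U = -1 := by
  simp [hh_U]

lemma hh_U_succ (n : ℕ) : coeff (n + 1) hh_U = 2 * hh_rho n + if n = 0 then 2 else 0 := by
  have e2 : (2 : ℝ⟦X⟧) = C 2 := (map_ofNat C 2).symm
  rw [hh_U, e2, mul_assoc, map_add, map_sub, coeff_C_mul, coeff_C_mul, coeff_succ_X_mul, coeff_X,
    coeff_one, hh_rho]
  rcases n with _ | n <;> simp
  ring

lemma hh_b_zero : hh_b 0 = 1 / 2 := by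
  rw [hh_b, hh_coeff_B, hh_U_zero]; simp

lemma hh_b_one : hh_b 1 = 2 := by
  rw [hh_b, hh_coeff_B, hh_U_succ, hh_rho_zero]; norm_num

lemma hh_b_two (n : ℕ) : hh_b (n + 2) = (3 * n + 5) * hh_rho (n + 1) := by
  rw [hh_b, hh_coeff_B, hh_U_succ]; push_cast; simp; ring

lemma hh_b_rec (j : ℕ) : hh_b (j + 2) =
    4 * (j + 1) * (3 * j + 5) * (3 * j + 1) / (j + 2) * hh_b j
    + 4 * (3 * j + 5) / (j + 2) * ∑ p ∈ antidiagonal (j + 1), hh_b p.1 * hh_b p.2 := by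
  have e2 : (2 : ℝ⟦X⟧) = C 2 := (map_ofNat C 2).symm
  have e4 : (4 : ℝ⟦X⟧) = C 4 := (map_ofNat C 4).symm
  have e28 : (28 : ℝ⟦X⟧) = C 28 := (map_ofNat C 28).symm
  have e12 : (12 : ℝ⟦X⟧) = C 12 := (map_ofNat C 12).symm
  have h := congrArg (coeff (j + 1)) hh_B_eq
  rw [e2, e4, e28, e12] at h
  simp only [map_add, coeff_C_mul, coeff_succ_X_mul, coeff_mul _ hh_B hh_B, coeff_derivative] at h
  have hs : ∑ p ∈ antidiagonal (j + 1), hh_b p.1 * hh_b p.2 =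
      (∑ p ∈ antidiagonal (j + 1), (coeff p.1) hh_B * (coeff p.2) hh_B) / 4 := by
    rw [Finset.sum_div]
    apply Finset.sum_congr rfl
    intros
    simp only [hh_b]; ring
  rw [hs]
  have hB := hh_coeff_B (j + 2)
  generalize ∑ p ∈ antidiagonal (j + 1), (coeff p.1) hh_B * (coeff p.2) hh_B = S at *
  have key : ((j : ℝ) + 2) * coeff (j + 2) hh_U
      = 4 * (j + 1) * (3 * j + 1) * coeff j hh_B + 2 * S := by
    rcases j with _ | _ | j
    · simp at h ⊢
      linarith
    · simp [coeff_derivative, coeff_succ_X_mul] at h ⊢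
      linarith
    · simp [coeff_derivative, coeff_succ_X_mul] at h ⊢
      linarith
  rw [hh_b, hB, hh_b]
  push_cast
  have hj : (j : ℝ) + 2 ≠ 0 := by positivity
  field_simp
  linear_combination (3 * (j : ℝ) + 5) * key

end

noncomputable def hh_e (n : ℕ) : ℝ := hh_c n / (6 ^ n * n.factorial)
noncomputable def hh_d (n : ℕ) : ℝ := hh_rho n / (6 ^ n * n.factorial)

lemma hh_e_pos (n : ℕ) : 0 < hh_e n := by
  have := hh_c_pos n
  unfold hh_e; positivity

lemma hh_d_nonneg (n : ℕ) : 0 ≤ hh_d n := by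
  have := hh_rho_nonneg n
  unfold hh_d; positivity

lemma hh_e_prod (n : ℕ) : hh_e n * (n.factorial : ℝ) ^ 2 =
    (∏ j ∈ range n, ((1 / 6 : ℝ) + j)) * ∏ j ∈ range n, ((1 - 1 / 6 : ℝ) + j) := by
  induction n with
  | zero => simp [hh_e, hh_c]
  | succ n ih =>
    rw [prod_range_succ, prod_range_succ]
    have h : hh_e (n + 1) * ((n + 1).factorial : ℝ) ^ 2 =
        (hh_e n * (n.factorial : ℝ) ^ 2) * ((1 / 6 + n) * (1 - 1 / 6 + n)) := by
      have : (n.factorial : ℝ) ≠ 0 := by positivity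
      rw [hh_e, hh_e, hh_c, Nat.factorial_succ, pow_succ]
      push_cast
      field_simp
      ring
    rw [h, ih]; ring

lemma hh_e_lim : Tendsto (fun n : ℕ => n * hh_e n) atTop (nhds (1 / (2 * Real.pi))) := by
  have h1 := Real.GammaSeq_tendsto_Gamma (1 / 6)
  have h2 := Real.GammaSeq_tendsto_Gamma (1 - 1 / 6)
  have h3 := (h1.mul h2)
  have hv : Real.Gamma (1 / 6) * Real.Gamma (1 - 1 / 6) = 2 * Real.pi := by
    rw [Real.Gamma_mul_Gamma_one_sub, mul_one_div, Real.sin_pi_div_six]; ring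
  rw [hv] at h3
  have h4 := h3.inv₀ (by positivity)
  have h5 : Tendsto (fun n : ℕ => ((n : ℝ) / (n + 1 / 6)) * ((n : ℝ) / (n + 5 / 6))) atTop
      (nhds (1 * 1)) := (tendsto_natCast_div_add_atTop (1 / 6 : ℝ)).mul
        (tendsto_natCast_div_add_atTop (5 / 6 : ℝ))
  have h6 := h5.mul h4
  rw [one_mul, one_mul, inv_eq_one_div] at h6
  refine h6.congr' ?_
  filter_upwards [eventually_ge_atTop 1] with n hn
  have hn' : (0 : ℝ) < n := by exact_mod_cast hn
  rw [Real.GammaSeq, Real.GammaSeq, prod_range_succ, prod_range_succ]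
  have hp := hh_e_prod n
  have hA : (0 : ℝ) < ∏ j ∈ range n, ((1 / 6 : ℝ) + j) := by
    apply prod_pos; intros; positivity
  have hB : (0 : ℝ) < ∏ j ∈ range n, ((1 - 1 / 6 : ℝ) + j) := by
    apply prod_pos; intros; norm_num; positivity
  have hr : (n : ℝ) ^ (1 / 6 : ℝ) * (n : ℝ) ^ (1 - 1 / 6 : ℝ) = n := by
    rw [← Real.rpow_add hn']; norm_num
  have hf : (0 : ℝ) < n.factorial := by positivity
  generalize ∏ j ∈ range n, ((1 / 6 : ℝ) + j) = A at *
  generalize ∏ j ∈ range n, ((1 - 1 / 6 : ℝ) + j) = B at *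
  have hpos1 : (0 : ℝ) < (n : ℝ) ^ (1 / 6 : ℝ) := by positivity
  have hpos2 : (0 : ℝ) < (n : ℝ) ^ (1 - 1 / 6 : ℝ) := by positivity
  generalize (n : ℝ) ^ (1 / 6 : ℝ) = x at *
  generalize (n : ℝ) ^ (1 - 1 / 6 : ℝ) = y at *
  have he : hh_e n = A * B / (n.factorial : ℝ) ^ 2 := by
    field_simp; linarith
  have e1 : x * n.factorial / (A * (1 / 6 + n)) * (y * n.factorial / (B * (1 - 1 / 6 + n)))
     = n * (n.factorial : ℝ) ^ 2 / (A * B * ((n + 1 / 6) * (n + 5 / 6))) := by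
    rw [div_mul_div_comm, ← hr]
    congr 1
    · ring
    · rw [hr]; ring
  rw [e1, he]
  field_simp

lemma hh_le_choose (n j : ℕ) (h1 : 1 ≤ j) (h2 : j < n) : n ≤ n.choose j := by
  induction n generalizing j with
  | zero => omega
  | succ n ih =>
    obtain ⟨j, rfl⟩ : ∃ k, j = k + 1 := ⟨j - 1, by omega⟩
    rcases Nat.eq_zero_or_pos j with rfl | hj
    · simp
    · rw [Nat.choose_succ_succ']
      have := ih j hj (by omega)
      have := Nat.choose_pos (n := n) (k := j + 1) (by omega)
      omega

lemma hh_conv' (n : ℕ) : hh_d (n + 1) = 6 * ((n + 1 : ℕ) * hh_e (n + 1))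
    - ∑ i ∈ range n, hh_d (n - i) * hh_e (i + 1) / ((n + 1).choose (i + 1)) := by
  have h := hh_conv (n + 1)
  rw [← Finset.Nat.sum_antidiagonal_swap] at h
  simp only [Prod.fst_swap, Prod.snd_swap] at h
  rw [Finset.Nat.sum_antidiagonal_eq_sum_range_succ (fun i j => hh_rho j * hh_c i),
    sum_range_succ, sum_range_succ'] at h
  simp only [Nat.sub_self, hh_rho_zero, hh_c, Nat.sub_zero] at h
  have hs : ∑ i ∈ range n, hh_d (n - i) * hh_e (i + 1) / ((n + 1).choose (i + 1)) =
     (∑ i ∈ range n, hh_rho (n + 1 - (i + 1)) * hh_c (i + 1)) / (6 ^ (n + 1) * (n + 1).factorial) := by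
    rw [sum_div]
    apply sum_congr rfl
    intro i hi
    rw [mem_range] at hi
    have hc := Nat.choose_mul_factorial_mul_factorial (n := n + 1) (k := i + 1) (by omega)
    have e : n + 1 - (i + 1) = n - i := by omega
    rw [e] at hc ⊢
    have hp : (6 : ℝ) ^ (n + 1) = 6 ^ (n - i) * 6 ^ (i + 1) := by
      rw [← pow_add]; congr 1; omega
    have hcpos : 0 < (n + 1).choose (i + 1) := Nat.choose_pos (by omega)
    rw [← hc, hp, hh_d, hh_e]
    push_cast
    have : ((n + 1).choose (i + 1) : ℝ) ≠ 0 := by positivity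
    field_simp
  rw [hs, hh_d, hh_e]
  have hpos : (0 : ℝ) < 6 ^ (n + 1) * (n + 1).factorial := by positivity
  field_simp
  simp only [hh_c] at h ⊢
  linarith

lemma hh_d_lim : Tendsto hh_d atTop (nhds (3 / Real.pi)) := by
  rw [← tendsto_add_atTop_iff_nat 1]
  obtain ⟨K, hK⟩ := hh_e_lim.bddAbove_range
  have hK' : ∀ n : ℕ, n * hh_e n ≤ K := fun n => hK ⟨n, rfl⟩
  have hK0 : 0 ≤ K := by simpa using hK' 0
  have hterm : ∀ n i : ℕ, i ∈ range n →
      0 ≤ hh_d (n - i) * hh_e (i + 1) / ((n + 1).choose (i + 1)) := fun n i _ =>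
    div_nonneg (mul_nonneg (hh_d_nonneg _) (hh_e_pos _).le) (by positivity)
  have hd : ∀ n : ℕ, hh_d n ≤ 6 * K := by
    intro n
    rcases n with _ | n
    · simp [hh_d, hh_rho_zero, hK0]
    · rw [hh_conv']
      have := sum_nonneg (hterm n)
      have := hK' (n + 1)
      linarith
  have hmain : Tendsto (fun n : ℕ => 6 * (((n + 1 : ℕ) : ℝ) * hh_e (n + 1))) atTop
      (nhds (3 / Real.pi)) := by
    have := ((tendsto_add_atTop_iff_nat 1).2 hh_e_lim).const_mul 6
    convert this using 2
    field_simp; norm_num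
  have hces : Tendsto (fun n : ℕ => 6 * K * K * ((n : ℝ)⁻¹ * ∑ i ∈ range n, (1 / ((i : ℝ) + 1))))
      atTop (nhds 0) := by
    have := (tendsto_one_div_add_atTop_nhds_zero_nat (𝕜 := ℝ)).cesaro.const_mul (6 * K * K)
    simpa using this
  have hsum : Tendsto (fun n : ℕ =>
      ∑ i ∈ range n, hh_d (n - i) * hh_e (i + 1) / ((n + 1).choose (i + 1))) atTop (nhds 0) := by
    refine squeeze_zero (fun n => sum_nonneg (hterm n)) (fun n => ?_) hces
    rw [mul_sum, mul_sum]
    apply sum_le_sum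
    intro i hi
    rw [mem_range] at hi
    have h1 : (n : ℝ) ≤ ((n + 1).choose (i + 1) : ℝ) := by
      exact_mod_cast (Nat.le_succ n).trans (hh_le_choose (n + 1) (i + 1) (by omega) (by omega))
    have hn : (0 : ℝ) < n := by exact_mod_cast (by omega : 0 < n)
    have h2 : hh_e (i + 1) ≤ K * (1 / ((i : ℝ) + 1)) := by
      have := hK' (i + 1)
      push_cast at this
      rw [mul_one_div, le_div_iff₀ (by positivity)]
      linarith
    calc hh_d (n - i) * hh_e (i + 1) / ((n + 1).choose (i + 1))
        ≤ (6 * K) * (K * (1 / ((i : ℝ) + 1))) / n := by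
          apply div_le_div₀ (by positivity) _ hn h1
          exact mul_le_mul (hd _) h2 (hh_e_pos _).le (by positivity)
      _ = _ := by field_simp
  have := hmain.sub hsum
  rw [sub_zero] at this
  exact this.congr fun n => (hh_conv' n).symm

lemma hh_sum_Icc {M : Type*} [AddCommMonoid M] (a : ℤ) (n : ℕ) (f : ℤ → M) :
    ∑ k ∈ Icc a (a + n), f k = ∑ i ∈ range (n + 1), f (a + i) := by
  refine Finset.sum_bij' (fun k _ => (k - a).toNat) (fun i _ => a + i) ?_ ?_ ?_ ?_ ?_
  · intro k hk; rw [mem_Icc] at hk; rw [mem_range]; omega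
  · intro k hk; rw [mem_range] at hk; rw [mem_Icc]; omega
  · intro k hk; rw [mem_Icc] at hk; omega
  · intro k hk; omega
  · intro k hk; rw [mem_Icc] at hk; congr 1; omega

lemma hh_vanish (H : ℤ → ℤ → ℚ)
    (hH1 : ∀ g : ℤ, H (-1) g = if g = 0 then 1/2 else 0)
    (hH2 : ∀ g : ℤ, H 0 g = if g = 0 then 2 else 0)
    (hHrec : ∀ n g : ℤ, 1 ≤ n → 0 ≤ g →
      H n g = (4*n*(3*n+2)*(3*n-2)/(n+1)) * H (n-2) (g-1)
        + (4*(3*n+2)/(n+1)) *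
          ∑ k ∈ Finset.Icc (-1 : ℤ) (n-1), ∑ i ∈ Finset.Icc (0 : ℤ) g,
            H k i * H (n-2-k) (g-i)) (m : ℕ) :
    ∀ n g : ℤ, n = m - 1 → 1 ≤ g → n < g → H n g = 0 := by
  induction m using Nat.strong_induction_on with
  | _ m ih =>
    intro n g hn hg hng
    rcases m with _ | _ | m
    · have : n = -1 := by omega
      rw [this, hH1, if_neg (by omega)]
    · have : n = 0 := by omega
      rw [this, hH2, if_neg (by omega)]
    · have hn1 : 1 ≤ n := by omega
      rw [hHrec n g hn1 (by omega), ih m (by omega) (n - 2) (g - 1) (by omega) (by omega) (by omega),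
        Finset.sum_eq_zero, mul_zero, mul_zero, add_zero]
      intro k hk
      apply Finset.sum_eq_zero
      intro i hi
      rw [mem_Icc] at hk hi
      by_cases hc : 1 ≤ i ∧ k < i
      · rw [ih (k + 1).toNat (by omega) k i (by omega) hc.1 hc.2, zero_mul]
      · rw [ih (n - 1 - k).toNat (by omega) (n - 2 - k) (g - i) (by omega) (by omega) (by omega),
          mul_zero]

noncomputable def hh_p (H : ℤ → ℤ → ℚ) (k : ℤ) : Polynomial ℚ :=
  ∑ g ∈ range (k.toNat + 1), Polynomial.monomial g (H k g)

lemma hh_p_coeff (H : ℤ → ℤ → ℚ)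
    (hH1 : ∀ g : ℤ, H (-1) g = if g = 0 then 1/2 else 0)
    (hH2 : ∀ g : ℤ, H 0 g = if g = 0 then 2 else 0)
    (hHrec : ∀ n g : ℤ, 1 ≤ n → 0 ≤ g →
      H n g = (4*n*(3*n+2)*(3*n-2)/(n+1)) * H (n-2) (g-1)
        + (4*(3*n+2)/(n+1)) *
          ∑ k ∈ Finset.Icc (-1 : ℤ) (n-1), ∑ i ∈ Finset.Icc (0 : ℤ) g,
            H k i * H (n-2-k) (g-i)) (k : ℤ) (hk : -1 ≤ k) (g : ℕ) :
    (hh_p H k).coeff g = H k g := by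
  simp only [hh_p, Polynomial.finsetSum_coeff, Polynomial.coeff_monomial]
  rw [Finset.sum_ite_eq']
  split_ifs with h
  · rfl
  · rw [mem_range] at h
    exact (hh_vanish H hH1 hH2 hHrec (k + 1).toNat k g (by omega) (by omega) (by omega)).symm

lemma hh_p_rec (H : ℤ → ℤ → ℚ)
    (hH1 : ∀ g : ℤ, H (-1) g = if g = 0 then 1/2 else 0)
    (hH2 : ∀ g : ℤ, H 0 g = if g = 0 then 2 else 0)
    (hH3 : ∀ n g : ℤ, g < 0 → H n g = 0)
    (hHrec : ∀ n g : ℤ, 1 ≤ n → 0 ≤ g →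
      H n g = (4*n*(3*n+2)*(3*n-2)/(n+1)) * H (n-2) (g-1)
        + (4*(3*n+2)/(n+1)) *
          ∑ k ∈ Finset.Icc (-1 : ℤ) (n-1), ∑ i ∈ Finset.Icc (0 : ℤ) g,
            H k i * H (n-2-k) (g-i)) (n : ℤ) (hn : 1 ≤ n) :
    hh_p H n = Polynomial.C ((4*n*(3*n+2)*(3*n-2)/(n+1)) : ℚ) * (Polynomial.X * hh_p H (n - 2))
      + Polynomial.C ((4*(3*n+2)/(n+1)) : ℚ) *
          ∑ k ∈ Finset.Icc (-1 : ℤ) (n-1), hh_p H k * hh_p H (n - 2 - k) := by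
  have hc := hh_p_coeff H hH1 hH2 hHrec
  ext g
  rw [hc n (by omega), hHrec n g hn (by omega)]
  simp only [Polynomial.coeff_add, Polynomial.coeff_C_mul, Polynomial.finsetSum_coeff]
  congr 2
  · rcases g with _ | g
    · rw [hH3 _ _ (by norm_num)]; simp
    · rw [Polynomial.coeff_X_mul, hc _ (by omega)]; congr 1; push_cast; ring
  · apply Finset.sum_congr rfl
    intro k hk
    rw [mem_Icc] at hk
    rw [Polynomial.coeff_mul, Finset.Nat.sum_antidiagonal_eq_sum_range_succ
      (fun i j => (hh_p H k).coeff i * (hh_p H (n - 2 - k)).coeff j)]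
    have := hh_sum_Icc 0 g (fun i => H k i * H (n - 2 - k) (g - i))
    simp only [zero_add] at this
    rw [this]
    apply Finset.sum_congr rfl
    intro i hi
    rw [mem_range] at hi
    rw [hc k (by omega), hc _ (by omega), Nat.cast_sub (by omega)]

lemma hh_eval (H : ℤ → ℤ → ℚ)
    (hH1 : ∀ g : ℤ, H (-1) g = if g = 0 then 1/2 else 0)
    (hH2 : ∀ g : ℤ, H 0 g = if g = 0 then 2 else 0)
    (hH3 : ∀ n g : ℤ, g < 0 → H n g = 0)
    (hHrec : ∀ n g : ℤ, 1 ≤ n → 0 ≤ g →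
      H n g = (4*n*(3*n+2)*(3*n-2)/(n+1)) * H (n-2) (g-1)
        + (4*(3*n+2)/(n+1)) *
          ∑ k ∈ Finset.Icc (-1 : ℤ) (n-1), ∑ i ∈ Finset.Icc (0 : ℤ) g,
            H k i * H (n-2-k) (g-i)) (m : ℕ) :
    (((hh_p H ((m : ℤ) - 1)).eval 1 : ℚ) : ℝ) = hh_b m := by
  induction m using Nat.strong_induction_on with
  | _ m ih =>
    rcases m with _ | _ | m
    · rw [hh_b_zero]; simp [hh_p, hH1]
    · rw [hh_b_one]; simp [hh_p, hH2]
    · have h := congrArg (Polynomial.eval 1) (hh_p_rec H hH1 hH2 hH3 hHrec (m + 1) (by omega))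
      simp only [Polynomial.eval_add, Polynomial.eval_mul, Polynomial.eval_C, Polynomial.eval_X,
        Polynomial.eval_finsetSum, one_mul] at h
      have h2 := hh_sum_Icc (-1) (m + 1) (fun k => Polynomial.eval 1 (hh_p H k) *
        Polynomial.eval 1 (hh_p H ((m : ℤ) + 1 - 2 - k)))
      have e1 : (-1 : ℤ) + ((m + 1 : ℕ) : ℤ) = (m : ℤ) + 1 - 1 := by push_cast; ring
      rw [e1] at h2
      rw [h2] at h
      have e2 : ((m + 1 + 1 : ℕ) : ℤ) - 1 = (m : ℤ) + 1 := by push_cast; ring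
      have e3 : (m : ℤ) + 1 - 2 = (m : ℤ) - 1 := by ring
      rw [e2, h, hh_b_rec, Finset.Nat.sum_antidiagonal_eq_sum_range_succ
        (fun i j => hh_b i * hh_b j), e3]
      push_cast
      rw [ih m (by omega)]
      have hs : ∑ i ∈ range (m + 1 + 1), (((hh_p H (-1 + (i : ℤ))).eval 1 : ℚ) : ℝ) *
          (((hh_p H ((m : ℤ) - 1 - (-1 + (i : ℤ)))).eval 1 : ℚ) : ℝ)
          = ∑ i ∈ range (m + 1).succ, hh_b i * hh_b (m + 1 - i) := by
        apply Finset.sum_congr rfl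
        intro i hi
        rw [mem_range] at hi
        rw [← ih i (by omega), ← ih (m + 1 - i) (by omega)]
        have e4 : -1 + (i : ℤ) = i - 1 := by ring
        have e5 : (m : ℤ) - 1 - (-1 + (i : ℤ)) = ((m + 1 - i : ℕ) : ℤ) - 1 := by omega
        rw [e5, e4]
      rw [hs]
      congr 2
      · congr 1 <;> ring
      · congr 1 <;> ring

/-- `h_n(1) = n^{-1} J_n(1) → 9/π` as `n → ∞`, i.e.
`(1/n!) 6^{-n} ∑_{g=0}^n H(n,g) ∼ (9/π) n`. -/
theorem h_at_one_tendsto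
    (H : ℤ → ℤ → ℚ)
    (hH1 : ∀ g : ℤ, H (-1) g = if g = 0 then 1/2 else 0)
    (hH2 : ∀ g : ℤ, H 0 g = if g = 0 then 2 else 0)
    (hH3 : ∀ n g : ℤ, g < 0 → H n g = 0)
    (hHrec : ∀ n g : ℤ, 1 ≤ n → 0 ≤ g →
      H n g = (4*n*(3*n+2)*(3*n-2)/(n+1)) * H (n-2) (g-1)
        + (4*(3*n+2)/(n+1)) *
          ∑ k ∈ Finset.Icc (-1 : ℤ) (n-1), ∑ i ∈ Finset.Icc (0 : ℤ) g,
            H k i * H (n-2-k) (g-i)) :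
    Tendsto
      (fun n : ℕ =>
        (n : ℝ)⁻¹ *
          ((Nat.factorial n : ℝ)⁻¹ * (6 : ℝ) ^ (-(n : ℤ)) *
            ∑ g ∈ Finset.Icc (0 : ℤ) (n : ℤ),
              ((H (n : ℤ) g : ℚ) : ℝ) * (1 : ℝ) ^ ((n : ℤ) + 2 - 2 * g)))
      atTop (nhds (9 / Real.pi)) := by
  have h1 : Tendsto (fun n : ℕ => (3 + 2 * (n : ℝ)⁻¹) * hh_d n) atTop
      (nhds ((3 + 2 * 0) * (3 / Real.pi))) :=
    ((tendsto_inv_atTop_nhds_zero_nat.const_mul 2).const_add 3).mul hh_d_lim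
  have e : (3 + 2 * 0) * (3 / Real.pi) = 9 / Real.pi := by ring
  rw [e] at h1
  refine h1.congr' ?_
  filter_upwards [eventually_ge_atTop 1] with n hn
  obtain ⟨n, rfl⟩ : ∃ k, n = k + 1 := ⟨n - 1, by omega⟩
  have h := hh_eval H hH1 hH2 hH3 hHrec (n + 2)
  rw [hh_b_two] at h
  have e2 : ((n + 2 : ℕ) : ℤ) - 1 = ((n + 1 : ℕ) : ℤ) := by push_cast; ring
  have h2 := hh_sum_Icc 0 (n + 1) (fun g => ((H ((n + 1 : ℕ) : ℤ) g : ℚ) : ℝ))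
  simp only [zero_add] at h2
  have h3 : (((hh_p H (((n + 2 : ℕ) : ℤ) - 1)).eval 1 : ℚ) : ℝ)
      = ∑ g ∈ range (n + 1 + 1), ((H ((n + 1 : ℕ) : ℤ) g : ℚ) : ℝ) := by
    rw [e2, hh_p]
    simp [Polynomial.eval_finsetSum]
  simp only [one_zpow, mul_one]
  rw [h2, ← h3, h, hh_d, zpow_neg, zpow_natCast]
  push_cast
  field_simp
  ring
end

section
/- Let a ≥ 0 and b be real numbers, let n₀ be an integer with n₀ > a, and let (d_n)_{n ≥ n₀} be a sequence of nonnegative real numbers satisfying d_n ≤ (1 − a/n)·d_{n−1} + n^{−b} for all n > n₀. Then there is a constant C (depending on a, b, n₀, d_{n₀}) such that for all n ≥ n₀: d_n ≤ C·( n^{−a}·(1 + δ·ln n) + n^{−(b−1)} ), where δ = 1 if b − a = 1 and δ = 0 otherwise. -/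
open Filter

theorem sum_rpow_bound_aux (c : ℝ) : ∃ C : ℝ, 0 ≤ C ∧ ∀ n : ℕ, 1 ≤ n →
    ∑ k ∈ Finset.range n, ((k : ℝ) + 1) ^ c ≤
      C * ((1 + (if c = -1 then (1 : ℝ) else 0) * Real.log n) + (n : ℝ) ^ (c + 1)) := by
  rcases lt_trichotomy c (-1) with hc | hc | hc
  · have hs : Summable (fun k : ℕ => ((k : ℝ) + 1) ^ c) := by
      have := (summable_nat_add_iff 1).2 (Real.summable_nat_rpow.2 hc)
      simpa using this
    have h0 : ∀ k : ℕ, 0 ≤ ((k : ℝ) + 1) ^ c := fun k => by positivity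
    refine ⟨∑' k : ℕ, ((k : ℝ) + 1) ^ c, tsum_nonneg h0, fun n hn => ?_⟩
    have h1 := hs.sum_le_tsum (Finset.range n) (fun k _ => h0 k)
    refine h1.trans ?_
    rw [if_neg hc.ne]
    apply le_mul_of_one_le_right (tsum_nonneg h0)
    have : 0 ≤ (n : ℝ) ^ (c + 1) := by positivity
    linarith
  · refine ⟨1, zero_le_one, fun n hn => ?_⟩
    have h := harmonic_le_one_add_log n
    have e : ((harmonic n : ℚ) : ℝ) = ∑ k ∈ Finset.range n, ((k : ℝ) + 1) ^ c := by
      rw [harmonic, hc]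
      push_cast
      exact Finset.sum_congr rfl fun k _ => (Real.rpow_neg_one _).symm
    rw [← e, if_pos hc]
    have : 0 ≤ (n : ℝ) ^ (c + 1) := by positivity
    linarith
  · have key : ∃ C : ℝ, 0 ≤ C ∧ ∀ n : ℕ, 1 ≤ n →
        ∑ k ∈ Finset.range n, ((k : ℝ) + 1) ^ c ≤ C * (n : ℝ) ^ (c + 1) := by
      rcases le_or_gt 0 c with h0 | h0
      · refine ⟨1, zero_le_one, fun n hn => ?_⟩
        have hn' : (0 : ℝ) < n := by exact_mod_cast hn
        have : ∀ k ∈ Finset.range n, ((k : ℝ) + 1) ^ c ≤ (n : ℝ) ^ c := by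
          intro k hk
          apply Real.rpow_le_rpow (by positivity) _ h0
          exact_mod_cast Finset.mem_range.1 hk
        have h2 := Finset.sum_le_card_nsmul _ _ _ this
        rw [Finset.card_range, nsmul_eq_mul] at h2
        rw [Real.rpow_add_one hn'.ne']
        linarith
      · have hp : 0 < c + 1 := by linarith
        refine ⟨(c + 1)⁻¹, by positivity, fun n _ => ?_⟩
        have step : ∀ k : ℕ, (c + 1) * ((k : ℝ) + 1) ^ c ≤
            ((k : ℝ) + 1) ^ (c + 1) - (k : ℝ) ^ (c + 1) := by
          intro k
          have hk : (0 : ℝ) < (k : ℝ) + 1 := by positivity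
          have hb := rpow_one_add_le_one_add_mul_self (s := -(1 / ((k : ℝ) + 1)))
            (by
              have : 1 / ((k : ℝ) + 1) ≤ 1 := by
                rw [div_le_one hk]
                linarith [(Nat.cast_nonneg k : (0 : ℝ) ≤ k)]
              linarith) hp.le (by linarith : c + 1 ≤ 1)
          have e1 : 1 + -(1 / ((k : ℝ) + 1)) = (k : ℝ) / ((k : ℝ) + 1) := by
            field_simp
            ring
          rw [e1, Real.div_rpow (by positivity) hk.le, div_le_iff₀ (by positivity)] at hb
          have e2 : ((k : ℝ) + 1) ^ (c + 1) = ((k : ℝ) + 1) ^ c * ((k : ℝ) + 1) :=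
            Real.rpow_add_one hk.ne' c
          have e3 : (1 + (c + 1) * -(1 / ((k : ℝ) + 1))) * ((k : ℝ) + 1) ^ (c + 1) =
              ((k : ℝ) + 1) ^ (c + 1) - (c + 1) * ((k : ℝ) + 1) ^ c := by
            rw [e2]
            field_simp
            ring
          linarith
        have hsum : (c + 1) * ∑ k ∈ Finset.range n, ((k : ℝ) + 1) ^ c ≤ (n : ℝ) ^ (c + 1) := by
          rw [Finset.mul_sum]
          refine (Finset.sum_le_sum fun k _ => step k).trans ?_
          have := Finset.sum_range_sub (fun k : ℕ => (k : ℝ) ^ (c + 1)) n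
          push_cast at this
          rw [this, Real.zero_rpow hp.ne', sub_zero]
        rw [inv_mul_eq_div, le_div_iff₀ hp]
        linarith
    obtain ⟨C, hC, h⟩ := key
    refine ⟨C, hC, fun n hn => (h n hn).trans ?_⟩
    rw [if_neg hc.ne']
    apply mul_le_mul_of_nonneg_left _ hC
    linarith

/-- Solutions of the recursive inequality `d_n ≤ (1 - a/n) d_{n-1} + n^{-b}`
(with `a ≥ 0`) satisfy `d_n = O(n^{-a} (1 + ⟦b-a=1⟧ ln n) + n^{-(b-1)})`. -/
theorem recursive_inequality_bound
    (a b : ℝ) (ha : 0 ≤ a) (n₀ : ℕ) (hn₀ : (a : ℝ) < n₀)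
    (d : ℕ → ℝ) (hd_nonneg : ∀ n : ℕ, n₀ ≤ n → 0 ≤ d n)
    (hd : ∀ n : ℕ, n₀ < n →
      d n ≤ (1 - a / n) * d (n - 1) + (n : ℝ) ^ (-b)) :
    ∃ C : ℝ, ∀ n : ℕ, n₀ ≤ n →
      d n ≤ C * ((n : ℝ) ^ (-a) *
          (1 + (if b - a = 1 then (1 : ℝ) else 0) * Real.log n) +
        (n : ℝ) ^ (-(b - 1))) := by
  obtain ⟨C, hC, hS⟩ := sum_rpow_bound_aux (a - b)
  have hn0 : 1 ≤ n₀ := by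
    have : (0 : ℝ) < n₀ := ha.trans_lt hn₀
    exact_mod_cast this
  set H : ℕ → ℝ := fun n => ((harmonic n : ℚ) : ℝ) with hH
  have hlog : ∀ n : ℕ, 1 ≤ n → Real.log n ≤ H n := by
    intro n hn
    have hn' : (0 : ℝ) < n := by exact_mod_cast hn
    refine le_trans ?_ (log_add_one_le_harmonic n)
    apply Real.log_le_log hn'
    push_cast
    linarith
  have hmain : ∀ n : ℕ, n₀ ≤ n → Real.exp (a * H n) * d n ≤
      Real.exp (a * H n₀) * d n₀ +
        Real.exp a * ∑ k ∈ Finset.range n, ((k : ℝ) + 1) ^ (a - b) := by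
    intro n hn
    induction n, hn using Nat.le_induction with
    | base =>
      have : 0 ≤ Real.exp a * ∑ k ∈ Finset.range n₀, ((k : ℝ) + 1) ^ (a - b) := by positivity
      linarith
    | succ n hn ih =>
      have h1 := hd (n + 1) (by omega)
      rw [Nat.add_sub_cancel] at h1
      push_cast at h1
      have hk : (0 : ℝ) < (n : ℝ) + 1 := by positivity
      have hHs : H (n + 1) = H n + 1 / ((n : ℝ) + 1) := by
        simp [hH, harmonic_succ]
      have hE : Real.exp (a * H (n + 1)) * (1 - a / ((n : ℝ) + 1)) ≤ Real.exp (a * H n) := by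
        have h2 : 1 - a / ((n : ℝ) + 1) ≤ Real.exp (-(a / ((n : ℝ) + 1))) :=
          Real.one_sub_le_exp_neg _
        calc _ ≤ Real.exp (a * H (n + 1)) * Real.exp (-(a / ((n : ℝ) + 1))) :=
              mul_le_mul_of_nonneg_left h2 (Real.exp_pos _).le
          _ = _ := by
              rw [← Real.exp_add, hHs]
              congr 1
              ring
      have hT : Real.exp (a * H (n + 1)) ≤ Real.exp a * ((n : ℝ) + 1) ^ a := by
        rw [Real.rpow_def_of_pos hk, ← Real.exp_add]
        apply Real.exp_le_exp.2
        have h3 := harmonic_le_one_add_log (n + 1)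
        push_cast at h3
        have h4 := mul_le_mul_of_nonneg_left h3 ha
        simp only [hH]
        linarith
      have hT2 : Real.exp (a * H (n + 1)) * ((n : ℝ) + 1) ^ (-b) ≤
          Real.exp a * ((n : ℝ) + 1) ^ (a - b) := by
        calc _ ≤ (Real.exp a * ((n : ℝ) + 1) ^ a) * ((n : ℝ) + 1) ^ (-b) :=
              mul_le_mul_of_nonneg_right hT (by positivity)
          _ = _ := by rw [mul_assoc, ← Real.rpow_add hk, sub_eq_add_neg]
      have h5 := mul_le_mul_of_nonneg_left h1 (Real.exp_pos (a * H (n + 1))).le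
      have h6 := mul_le_mul_of_nonneg_right hE (hd_nonneg n hn)
      rw [Finset.sum_range_succ]
      nlinarith
  set K : ℝ := Real.exp (a * H n₀) * d n₀ with hK
  have hK0 : 0 ≤ K := mul_nonneg (Real.exp_pos _).le (hd_nonneg n₀ le_rfl)
  refine ⟨K + Real.exp a * C, fun n hn => ?_⟩
  have hn1 : 1 ≤ n := hn0.trans hn
  have hn' : (0 : ℝ) < n := by exact_mod_cast hn1
  have hiff : (b - a = 1) = (a - b = -1) := by
    apply propext
    constructor <;> intro h <;> linarith
  have hS' := hS n hn1
  simp only [hiff]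
  set L : ℝ := (if a - b = -1 then (1 : ℝ) else 0) * Real.log n with hL
  have hL0 : 0 ≤ L := by
    apply mul_nonneg
    · split_ifs <;> norm_num
    · exact Real.log_natCast_nonneg n
  have hP : 0 ≤ (n : ℝ) ^ (a - b + 1) := by positivity
  have h1 : (n : ℝ) ^ a * d n ≤ (K + Real.exp a * C) * ((1 + L) + (n : ℝ) ^ (a - b + 1)) := by
    have h2 : (n : ℝ) ^ a ≤ Real.exp (a * H n) := by
      rw [Real.rpow_def_of_pos hn']
      apply Real.exp_le_exp.2
      have := mul_le_mul_of_nonneg_left (hlog n hn1) ha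
      linarith
    have h3 := mul_le_mul_of_nonneg_right h2 (hd_nonneg n hn)
    have h4 := hmain n hn
    have h5 := mul_le_mul_of_nonneg_left hS' (Real.exp_pos a).le
    have h6 : K ≤ K * ((1 + L) + (n : ℝ) ^ (a - b + 1)) :=
      le_mul_of_one_le_right hK0 (by linarith)
    linarith
  have h7 := mul_le_mul_of_nonneg_left h1 (by positivity : 0 ≤ (n : ℝ) ^ (-a))
  have e1 : (n : ℝ) ^ (-a) * ((n : ℝ) ^ a * d n) = d n := by
    rw [← mul_assoc, ← Real.rpow_add hn']
    simp
  have e2 : (n : ℝ) ^ (-(b - 1)) = (n : ℝ) ^ (-a) * (n : ℝ) ^ (a - b + 1) := by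
    rw [← Real.rpow_add hn']
    congr 1
    ring
  rw [e1] at h7
  rw [e2]
  linarith
end

section
/- For all integers n ≥ 20 and all real y with 0 ≤ y ≤ 2, one has Σ_{k=3}^{n−5} (1/C(n−2,k)) · ( k(n−2−k)/n )^{y+1} < 1/4, where C(n−2,k) denotes the binomial coefficient (n−2 choose k). -/
lemma poly_step (k j : ℝ) (hk : 3 ≤ k) (hj : k + 2 ≤ j) :
    (k + 1) ^ 4 * (j - 1) ^ 3 ≤ k ^ 3 * j ^ 4 := by
  obtain ⟨s, rfl⟩ : ∃ s, k = 3 + s := ⟨k - 3, by ring⟩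
  obtain ⟨t, rfl⟩ : ∃ t, j = 3 + s + 2 + t := ⟨j - (3 + s + 2), by ring⟩
  have hs : 0 ≤ s := by linarith
  have ht : 0 ≤ t := by linarith
  rw [← sub_nonneg]
  ring_nf
  positivity

lemma key_half (m : ℕ) (k : ℕ) (hk : 3 ≤ k) : 2 * k ≤ m →
    ((k : ℝ) * ((m : ℝ) - k)) ^ 3 * (m.choose 3 : ℝ) ≤
      (3 * ((m : ℝ) - 3)) ^ 3 * (m.choose k : ℝ) := by
  induction k, hk using Nat.le_induction with
  | base => intro _; norm_num
  | succ k hk ih =>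
    intro h
    have h1 := ih (by omega)
    have hid : (m.choose (k + 1) : ℝ) * ((k : ℝ) + 1) = m.choose k * ((m : ℝ) - k) := by
      have := Nat.choose_succ_right_eq m k
      have h2 : ((m - k : ℕ) : ℝ) = (m : ℝ) - k := Nat.cast_sub (by omega)
      rw [← h2]; exact_mod_cast this
    have hk' : (3 : ℝ) ≤ k := by exact_mod_cast hk
    have hm' : 2 * ((k : ℝ) + 1) ≤ m := by exact_mod_cast h
    have hp := poly_step k ((m : ℝ) - k) hk' (by linarith)
    set j : ℝ := (m : ℝ) - k with hj
    have hjp : 0 < j := by linarith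
    have hkp : (0 : ℝ) < k := by linarith
    push_cast
    have e : (m : ℝ) - (k + 1) = j - 1 := by rw [hj]; ring
    rw [e]
    have hpos : 0 < ((k : ℝ) + 1) * (k ^ 3 * j ^ 3) := by positivity
    refine le_of_mul_le_mul_right ?_ hpos
    have hC : (0 : ℝ) ≤ m.choose 3 := by positivity
    calc (((k : ℝ) + 1) * (j - 1)) ^ 3 * (m.choose 3 : ℝ) * (((k : ℝ) + 1) * (k ^ 3 * j ^ 3))
        = ((k + 1) ^ 4 * (j - 1) ^ 3) * ((m.choose 3 : ℝ) * (k ^ 3 * j ^ 3)) := by ring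
      _ ≤ (k ^ 3 * j ^ 4) * ((m.choose 3 : ℝ) * (k ^ 3 * j ^ 3)) := by gcongr
      _ = (k ^ 3 * j ^ 4) * (((k : ℝ) * j) ^ 3 * (m.choose 3 : ℝ)) := by ring
      _ ≤ (k ^ 3 * j ^ 4) * ((3 * ((m : ℝ) - 3)) ^ 3 * (m.choose k : ℝ)) := by gcongr
      _ = (3 * ((m : ℝ) - 3)) ^ 3 * (m.choose k * j) * (k ^ 3 * j ^ 3) := by ring
      _ = _ := by rw [← hid]; ring

lemma key_all (m k : ℕ) (hk : 3 ≤ k) (hkm : k + 3 ≤ m) :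
    ((k : ℝ) * ((m : ℝ) - k)) ^ 3 * (m.choose 3 : ℝ) ≤
      (3 * ((m : ℝ) - 3)) ^ 3 * (m.choose k : ℝ) := by
  by_cases h : 2 * k ≤ m
  · exact key_half m k hk h
  · have := key_half m (m - k) (by omega) (by omega)
    rw [Nat.choose_symm (by omega), Nat.cast_sub (by omega)] at this
    convert this using 2
    ring

/-- For `n ≥ 20` and `0 ≤ y ≤ 2`,
`∑_{k=3}^{n-5} (1/(n-2 choose k)) (k(n-2-k)/n)^{y+1} < 1/4`. -/
theorem binomial_sum_lt_quarter :
    ∀ n : ℕ, 20 ≤ n → ∀ y : ℝ, 0 ≤ y → y ≤ 2 →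
      ∑ k ∈ Finset.Icc 3 (n - 5),
          (1 / (Nat.choose (n - 2) k : ℝ)) *
            ((k : ℝ) * ((n : ℝ) - 2 - (k : ℝ)) / (n : ℝ)) ^ (y + 1)
        < 1 / 4 := by
  intro n hn y hy0 hy2
  have hn' : (20 : ℝ) ≤ n := by exact_mod_cast hn
  have hC3 : ((n - 2).choose 3 : ℝ) * 6 = ((n : ℝ) - 2) * (n - 3) * (n - 4) := by
    obtain ⟨t, rfl⟩ : ∃ t, n = t + 4 := ⟨n - 4, by omega⟩
    have h1 := Nat.choose_succ_right_eq (t + 2) 2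
    have h2 := Nat.choose_succ_right_eq (t + 2) 1
    simp only [Nat.choose_one_right] at h2
    have e1 : t + 2 - 2 = t := by omega
    have e2 : t + 2 - 1 = t + 1 := by omega
    have e3 : t + 4 - 2 = t + 2 := by omega
    rw [e1] at h1
    rw [e2] at h2
    rw [e3]
    norm_num at h1 h2
    have h1' : ((t + 2).choose 3 : ℝ) * 3 = (t + 2).choose 2 * t := by exact_mod_cast h1
    have h2' : ((t + 2).choose 2 : ℝ) * 2 = (t + 2) * (t + 1) := by exact_mod_cast h2
    push_cast
    linear_combination 2 * h1' + (t : ℝ) * h2'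
  have hC3p : (0 : ℝ) < (n - 2).choose 3 := by
    exact_mod_cast Nat.choose_pos (by omega)
  set B : ℝ := (3 * ((n : ℝ) - 5)) ^ 3 / ((n : ℝ) ^ 3 * (n - 2).choose 3) with hB
  have hterm : ∀ k ∈ Finset.Icc 3 (n - 5), (1 / (Nat.choose (n - 2) k : ℝ)) *
            ((k : ℝ) * ((n : ℝ) - 2 - (k : ℝ)) / (n : ℝ)) ^ (y + 1) ≤ B := by
    intro k hk
    rw [Finset.mem_Icc] at hk
    have hkey := key_all (n - 2) k hk.1 (by omega)
    rw [Nat.cast_sub (by omega)] at hkey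
    push_cast at hkey
    have hk3 : (3 : ℝ) ≤ k := by exact_mod_cast hk.1
    have hk5 : (k : ℝ) + 5 ≤ n := by exact_mod_cast (by omega : k + 5 ≤ n)
    have hCk : (0 : ℝ) < (n - 2).choose k := by
      exact_mod_cast Nat.choose_pos (by omega)
    have hbase : 1 ≤ (k : ℝ) * ((n : ℝ) - 2 - (k : ℝ)) / (n : ℝ) := by
      rw [le_div_iff₀ (by linarith)]
      nlinarith [mul_nonneg (sub_nonneg.2 hk3) (sub_nonneg.2 hk5)]
    have hr : ((k : ℝ) * ((n : ℝ) - 2 - (k : ℝ)) / (n : ℝ)) ^ (y + 1) ≤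
        ((k : ℝ) * ((n : ℝ) - 2 - (k : ℝ)) / (n : ℝ)) ^ 3 := by
      rw [← Real.rpow_natCast]
      apply Real.rpow_le_rpow_of_exponent_le hbase
      push_cast; linarith
    calc _ ≤ (1 / (Nat.choose (n - 2) k : ℝ)) *
          ((k : ℝ) * ((n : ℝ) - 2 - (k : ℝ)) / (n : ℝ)) ^ 3 := by gcongr
      _ = ((k : ℝ) * ((n : ℝ) - 2 - (k : ℝ))) ^ 3 / ((n : ℝ) ^ 3 * (n - 2).choose k) := by
          rw [div_pow]; field_simp
      _ ≤ B := by
          rw [hB, div_le_div_iff₀ (by positivity) (by positivity)]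
          have e : (n : ℝ) - 2 - 3 = n - 5 := by ring
          rw [e] at hkey
          have := mul_le_mul_of_nonneg_left hkey (by positivity : (0 : ℝ) ≤ (n : ℝ) ^ 3)
          linarith
  refine (Finset.sum_le_card_nsmul _ _ B hterm).trans_lt ?_
  rw [Nat.card_Icc, nsmul_eq_mul]
  have e : ((n - 5 + 1 - 3 : ℕ) : ℝ) = (n : ℝ) - 7 := by
    rw [show n - 5 + 1 - 3 = n - 7 by omega, Nat.cast_sub (by omega)]; norm_num
  rw [e, hB, ← mul_div_assoc, div_lt_div_iff₀ (by positivity) (by norm_num)]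
  have hfin : (n - 7) * (3 * ((n : ℝ) - 5)) ^ 3 * 4 * 6 <
      (n : ℝ) ^ 3 * (((n : ℝ) - 2) * (n - 3) * (n - 4)) := by
    obtain ⟨t, ht⟩ : ∃ t : ℝ, (n : ℝ) = 20 + t := ⟨n - 20, by ring⟩
    have ht0 : 0 ≤ t := by linarith
    rw [ht, ← sub_pos]
    ring_nf
    positivity
  rw [← hC3] at hfin
  linarith
end
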